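/- Let C be a unital b-category with induced braiding c, define the associator α_{X,Y,Z} := c_{Z,X⊗Y} ∘ β_{Z,X,Y}^{-1} ∘ (1_X ⊗ c_{Z,Y}^{-1}) : X⊗(Y⊗Z) → (X⊗Y)⊗Z and the left unit isomorphism λ_X := ρ_X ∘ c_{I,X} : I⊗X → X. Then the monoidal unit axiom holds: for all objects X, Y, (ρ_X ⊗ 1_Y) ∘ α_{X,I,Y} = 1_X ⊗ λ_Y as morphisms X⊗(I⊗Y) → X⊗Y. -/

import Mathlib

open CategoryTheory

universe v u

/-- A b-category: a category with a tensor product functor `⊗ : C × C → C` and a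
natural family of isomorphisms `β_{X,Y,Z} : X⊗(Y⊗Z) ≅ Y⊗(X⊗Z)` satisfying the
permutohedron coherence. -/
structure BCat (C : Type u) [Category.{v} C] where
  tensorObj : C → C → C
  tensorHom : ∀ {X₁ Y₁ X₂ Y₂ : C}, (X₁ ⟶ Y₁) → (X₂ ⟶ Y₂) →
    (tensorObj X₁ X₂ ⟶ tensorObj Y₁ Y₂)
  tensorHom_id : ∀ (X Y : C), tensorHom (𝟙 X) (𝟙 Y) = 𝟙 (tensorObj X Y)
  tensorHom_comp : ∀ {X₁ Y₁ Z₁ X₂ Y₂ Z₂ : C} (f₁ : X₁ ⟶ Y₁) (g₁ : Y₁ ⟶ Z₁)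
    (f₂ : X₂ ⟶ Y₂) (g₂ : Y₂ ⟶ Z₂),
    tensorHom (f₁ ≫ g₁) (f₂ ≫ g₂) = tensorHom f₁ f₂ ≫ tensorHom g₁ g₂
  β : ∀ (X Y Z : C), tensorObj X (tensorObj Y Z) ≅ tensorObj Y (tensorObj X Z)
  β_natural : ∀ {X₁ Y₁ X₂ Y₂ X₃ Y₃ : C} (f : X₁ ⟶ Y₁) (g : X₂ ⟶ Y₂) (h : X₃ ⟶ Y₃),
    tensorHom f (tensorHom g h) ≫ (β Y₁ Y₂ Y₃).hom
      = (β X₁ X₂ X₃).hom ≫ tensorHom g (tensorHom f h)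
  b_coherence : ∀ (X Y Z W : C),
    tensorHom (𝟙 X) (β Y Z W).hom ≫ (β X Z (tensorObj Y W)).hom
        ≫ tensorHom (𝟙 Z) (β X Y W).hom
      = (β X Y (tensorObj Z W)).hom ≫ tensorHom (𝟙 Y) (β X Z W).hom
        ≫ (β Y Z (tensorObj X W)).hom

/-- A unital b-category: a b-category with a unit object `I` and a natural family
of isomorphisms `ρ_X : X ⊗ I ≅ X`, required (below) to satisfy the unit
coherence `UnitCoh` and the mixed coherence `MixedCoh`. -/
structure UBCat (C : Type u) [Category.{v} C] extends BCat C where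
  unit : C
  ρ : ∀ X : C, tensorObj X unit ≅ X
  ρ_natural : ∀ {X Y : C} (f : X ⟶ Y),
    tensorHom f (𝟙 unit) ≫ (ρ Y).hom = (ρ X).hom ≫ f

variable {C : Type u} [Category.{v} C]

/-- Tensoring an isomorphism with an identity on the left, as an isomorphism. -/
def UBCat.idTensor (B : UBCat C) (X : C) {Y Y' : C} (e : Y ≅ Y') :
    B.tensorObj X Y ≅ B.tensorObj X Y' where
  hom := B.tensorHom (𝟙 X) e.hom
  inv := B.tensorHom (𝟙 X) e.inv
  hom_inv_id := by rw [← B.tensorHom_comp]; simp [B.tensorHom_id]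
  inv_hom_id := by rw [← B.tensorHom_comp]; simp [B.tensorHom_id]

/-- The induced braiding `c_{X,Y} = (1_Y ⊗ ρ_X) ∘ β_{X,Y,I} ∘ (1_X ⊗ ρ_Y⁻¹)`
of a unital b-category. -/
def UBCat.c (B : UBCat C) (X Y : C) : B.tensorObj X Y ≅ B.tensorObj Y X :=
  B.idTensor X (B.ρ Y).symm ≪≫ B.β X Y B.unit ≪≫ B.idTensor Y (B.ρ X)

/-- The unit coherence of a unital b-category:
`c_{X⊗Y,I} ∘ ρ_{X⊗Y}⁻¹ = β_{X,I,Y} ∘ (1_X ⊗ c_{Y,I}) ∘ (1_X ⊗ ρ_Y⁻¹)`. -/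
def UBCat.UnitCoh (B : UBCat C) : Prop :=
  ∀ X Y : C,
    (B.ρ (B.tensorObj X Y)).inv ≫ (B.c (B.tensorObj X Y) B.unit).hom
      = B.tensorHom (𝟙 X) (B.ρ Y).inv ≫ B.tensorHom (𝟙 X) (B.c Y B.unit).hom
          ≫ (B.β X B.unit Y).hom

/-- The mixed coherence of a unital b-category:
`(1_X ⊗ c_{Z⊗W,Y}) ∘ β_{Z⊗W,X,Y} ∘ c_{X⊗Y,Z⊗W}
  = (1_X ⊗ β_{Z,Y,W}) ∘ (1_X ⊗ (1_Z ⊗ c_{W,Y})) ∘ β_{Z,X,W⊗Y} ∘ (1_Z ⊗ β_{W,X,Y})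
      ∘ (1_Z ⊗ c_{X⊗Y,W}) ∘ β_{X⊗Y,Z,W}`. -/
def UBCat.MixedCoh (B : UBCat C) : Prop :=
  ∀ X Y Z W : C,
    (B.c (B.tensorObj X Y) (B.tensorObj Z W)).hom ≫ (B.β (B.tensorObj Z W) X Y).hom
        ≫ B.tensorHom (𝟙 X) (B.c (B.tensorObj Z W) Y).hom
      = (B.β (B.tensorObj X Y) Z W).hom
          ≫ B.tensorHom (𝟙 Z) (B.c (B.tensorObj X Y) W).hom
          ≫ B.tensorHom (𝟙 Z) (B.β W X Y).hom
          ≫ (B.β Z X (B.tensorObj W Y)).hom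
          ≫ B.tensorHom (𝟙 X) (B.tensorHom (𝟙 Z) (B.c W Y).hom)
          ≫ B.tensorHom (𝟙 X) (B.β Z Y W).hom

namespace UBCat

section

variable (B : UBCat C)

theorem tensorHom_comp_tensorHom {X₁ Y₁ Z₁ X₂ Y₂ Z₂ : C} (f₁ : X₁ ⟶ Y₁) (g₁ : Y₁ ⟶ Z₁)
    (f₂ : X₂ ⟶ Y₂) (g₂ : Y₂ ⟶ Z₂) :
    B.tensorHom f₁ f₂ ≫ B.tensorHom g₁ g₂ = B.tensorHom (f₁ ≫ g₁) (f₂ ≫ g₂) :=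
  (B.tensorHom_comp f₁ g₁ f₂ g₂).symm

theorem tensorHom_comp_tensorHom_assoc {X₁ Y₁ Z₁ X₂ Y₂ Z₂ W : C} (f₁ : X₁ ⟶ Y₁) (g₁ : Y₁ ⟶ Z₁)
    (f₂ : X₂ ⟶ Y₂) (g₂ : Y₂ ⟶ Z₂) (k : B.tensorObj Z₁ Z₂ ⟶ W) :
    B.tensorHom f₁ f₂ ≫ B.tensorHom g₁ g₂ ≫ k = B.tensorHom (f₁ ≫ g₁) (f₂ ≫ g₂) ≫ k := by
  rw [B.tensorHom_comp, Category.assoc]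

theorem β_natural_assoc {X₁ Y₁ X₂ Y₂ X₃ Y₃ W : C} (f : X₁ ⟶ Y₁) (g : X₂ ⟶ Y₂) (h : X₃ ⟶ Y₃)
    (k : B.tensorObj Y₂ (B.tensorObj Y₁ Y₃) ⟶ W) :
    B.tensorHom f (B.tensorHom g h) ≫ (B.β Y₁ Y₂ Y₃).hom ≫ k
      = (B.β X₁ X₂ X₃).hom ≫ B.tensorHom g (B.tensorHom f h) ≫ k := by
  rw [← Category.assoc, B.β_natural, Category.assoc]

instance isIso_tensorHom {X₁ Y₁ X₂ Y₂ : C} (f : X₁ ⟶ Y₁) (g : X₂ ⟶ Y₂) [IsIso f] [IsIso g] :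
    IsIso (B.tensorHom f g) :=
  ⟨B.tensorHom (inv f) (inv g), by simp [tensorHom_comp_tensorHom, B.tensorHom_id]⟩

theorem c_naturality {X X' Y Y' : C} (f : X ⟶ X') (g : Y ⟶ Y') :
    B.tensorHom f g ≫ (B.c X' Y').hom = (B.c X Y).hom ≫ B.tensorHom g f := by
  have hg : g ≫ (B.ρ Y').inv = (B.ρ Y).inv ≫ B.tensorHom g (𝟙 B.unit) := by
    rw [Iso.comp_inv_eq, Category.assoc, B.ρ_natural, Iso.inv_hom_id_assoc]
  calc B.tensorHom f g ≫ (B.c X' Y').hom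
      = B.tensorHom (𝟙 X ≫ f) (g ≫ (B.ρ Y').inv) ≫ (B.β X' Y' B.unit).hom ≫
          B.tensorHom (𝟙 Y') (B.ρ X').hom := by
        simp [c, idTensor, tensorHom_comp_tensorHom_assoc]
    _ = (B.c X Y).hom ≫ B.tensorHom g f := by
        rw [hg, B.tensorHom_comp, Category.assoc,
          B.β_natural_assoc, ← B.tensorHom_comp, B.ρ_natural]
        simp [c, idTensor, tensorHom_comp_tensorHom]

theorem c_naturality_assoc {X X' Y Y' W : C} (f : X ⟶ X') (g : Y ⟶ Y')
    (k : B.tensorObj Y' X' ⟶ W) :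
    B.tensorHom f g ≫ (B.c X' Y').hom ≫ k = (B.c X Y).hom ≫ B.tensorHom g f ≫ k := by
  rw [← Category.assoc, B.c_naturality, Category.assoc]

theorem tensorHom_comp_c_assoc {X X' Y Y' W : C} (f : X ⟶ X') (g : Y ⟶ Y')
    (k : B.tensorObj Y' X' ⟶ W) :
    B.tensorHom f g ≫ (B.c X' Y').hom ≫ k
      = B.tensorHom (𝟙 X) g ≫ (B.c X Y').hom ≫ B.tensorHom (𝟙 Y') f ≫ k := by
  rw [← B.c_naturality_assoc, tensorHom_comp_tensorHom_assoc, Category.id_comp, Category.comp_id]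

theorem β_unit_right (X Y : C) :
    (B.β X Y B.unit).hom =
      B.tensorHom (𝟙 X) (B.ρ Y).hom ≫ (B.c X Y).hom ≫ B.tensorHom (𝟙 Y) (B.ρ X).inv := by
  simp [c, idTensor, tensorHom_comp_tensorHom, tensorHom_comp_tensorHom_assoc, B.tensorHom_id]

theorem ρ_tensor_unit (X : C) :
    (B.ρ (B.tensorObj X B.unit)).hom = B.tensorHom (B.ρ X).hom (𝟙 B.unit) := by
  rw [← cancel_mono (B.ρ X).hom, B.ρ_natural]

theorem ρ_tensor_unit_inv (X : C) :
    (B.ρ (B.tensorObj X B.unit)).inv = B.tensorHom (B.ρ X).inv (𝟙 B.unit) := by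
  rw [← cancel_mono (B.ρ (B.tensorObj X B.unit)).hom, Iso.inv_hom_id,
    B.ρ_tensor_unit, ← B.tensorHom_comp]
  simp [B.tensorHom_id]

theorem eq_id_of_tensor_unit {X : C} {f : X ⟶ X}
    (h : B.tensorHom f (𝟙 B.unit) = 𝟙 _) : f = 𝟙 X := by
  rw [← cancel_epi (B.ρ X).hom, ← B.ρ_natural, h, Category.id_comp, Category.comp_id]

theorem eq_id_of_unit_tensor {X : C} {f : X ⟶ X}
    (h : B.tensorHom (𝟙 B.unit) f = 𝟙 _) : f = 𝟙 X := by
  apply B.eq_id_of_tensor_unit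
  rw [← cancel_mono (B.c X B.unit).hom, B.c_naturality, h, Category.id_comp, Category.comp_id]

end

variable {B : UBCat C}

theorem c_unit_unit (h : B.UnitCoh) : (B.c B.unit B.unit).hom = 𝟙 _ := by
  have key := h B.unit B.unit
  rw [B.ρ_tensor_unit_inv, B.c_naturality, B.β_unit_right] at key
  simp only [← Category.assoc, cancel_mono] at key
  rw [eq_comm] at key
  have hθ := (cancel_mono _).1 (key.trans (Category.id_comp _).symm)
  simp only [tensorHom_comp_tensorHom, Category.comp_id] at hθ
  have := B.eq_id_of_unit_tensor hθ
  rw [Category.assoc, Iso.inv_comp_eq, Category.comp_id] at this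
  rwa [← cancel_mono (B.ρ B.unit).hom, Category.id_comp]

theorem c_unit_symmetry (h₁ : B.UnitCoh) (h₂ : B.MixedCoh) (X : C) :
    (B.c X B.unit).hom ≫ (B.c B.unit X).hom = 𝟙 _ := by
  have key := h₂ X B.unit B.unit B.unit
  have hII : (B.c (B.tensorObj B.unit B.unit) B.unit).hom =
      B.tensorHom (B.ρ B.unit).hom (B.ρ B.unit).inv := by
    rw [← cancel_mono (B.tensorHom (𝟙 B.unit) (B.ρ B.unit).hom), ← B.c_naturality,
      c_unit_unit h₁, ← B.tensorHom_comp]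
    simp
  have hβ : (B.β B.unit B.unit B.unit).hom = 𝟙 _ := by
    rw [B.β_unit_right, c_unit_unit h₁, Category.id_comp, ← B.tensorHom_comp]
    simp [B.tensorHom_id]
  have hβ' : (B.β B.unit X (B.tensorObj B.unit B.unit)).hom =
      B.tensorHom (𝟙 B.unit) (B.tensorHom (𝟙 X) (B.ρ B.unit).hom) ≫
        (B.β B.unit X B.unit).hom ≫
        B.tensorHom (𝟙 X) (B.tensorHom (𝟙 B.unit) (B.ρ B.unit).inv) := by
    rw [B.β_natural_assoc]
    simp [tensorHom_comp_tensorHom, B.tensorHom_id]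
  have lhs : (B.c (B.tensorObj X B.unit) (B.tensorObj B.unit B.unit)).hom ≫
      (B.β (B.tensorObj B.unit B.unit) X B.unit).hom ≫
      B.tensorHom (𝟙 X) (B.c (B.tensorObj B.unit B.unit) B.unit).hom =
      B.tensorHom (B.ρ X).hom (B.ρ B.unit).hom ≫ (B.c X B.unit).hom ≫ (B.c B.unit X).hom ≫
        B.tensorHom (𝟙 X) ((B.ρ B.unit).inv ≫
          B.tensorHom (𝟙 B.unit) (B.ρ B.unit).inv) := by
    rw [B.c_naturality_assoc, B.tensorHom_comp_c_assoc, B.β_unit_right, hII, B.ρ_tensor_unit_inv]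
    simp [tensorHom_comp_tensorHom]
  have rhs : (B.β (B.tensorObj X B.unit) B.unit B.unit).hom ≫
      B.tensorHom (𝟙 B.unit) (B.c (B.tensorObj X B.unit) B.unit).hom ≫
      B.tensorHom (𝟙 B.unit) (B.β B.unit X B.unit).hom ≫
      (B.β B.unit X (B.tensorObj B.unit B.unit)).hom ≫
      B.tensorHom (𝟙 X) (B.tensorHom (𝟙 B.unit) (B.c B.unit B.unit).hom) ≫
      B.tensorHom (𝟙 X) (B.β B.unit B.unit B.unit).hom =
      B.tensorHom (B.ρ X).hom (B.ρ B.unit).hom ≫ (B.c X B.unit).hom ≫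
        B.tensorHom (𝟙 B.unit) ((B.ρ X).inv ≫ (B.c X B.unit).hom ≫ (B.c B.unit X).hom ≫
          (B.ρ X).hom) ≫ (B.c B.unit X).hom ≫
        B.tensorHom (𝟙 X) ((B.ρ B.unit).inv ≫
          B.tensorHom (𝟙 B.unit) (B.ρ B.unit).inv) := by
    have hc : (B.c (B.tensorObj X B.unit) B.unit).hom =
        B.tensorHom (B.ρ X).hom (𝟙 B.unit) ≫ (B.c X B.unit).hom ≫
          B.tensorHom (𝟙 B.unit) (B.ρ X).inv := by
      rw [B.c_naturality_assoc, tensorHom_comp_tensorHom]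
      simp [B.tensorHom_id]
    rw [B.tensorHom_comp_c_assoc, hβ', hβ, c_unit_unit h₁]
    simp only [B.β_unit_right, B.ρ_tensor_unit_inv, B.tensorHom_id, Category.comp_id,
      Category.assoc, tensorHom_comp_tensorHom, tensorHom_comp_tensorHom_assoc]
    rw [hc]
    simp [tensorHom_comp_tensorHom_assoc, B.tensorHom_id]
  rw [lhs, rhs, cancel_epi, cancel_epi, ← Category.assoc, cancel_mono] at key
  have hθ := B.eq_id_of_unit_tensor (((cancel_mono _).1 ((Category.id_comp _).trans key)).symm)
  rw [Iso.inv_comp_eq, Category.comp_id, ← Category.assoc] at hθ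
  rwa [← cancel_mono (B.ρ X).hom, Category.id_comp]

end UBCat

/-- in a unital b-category, with the associator
`α_{X,Y,Z} = c_{Z,X⊗Y} ∘ β_{Z,X,Y}⁻¹ ∘ (1_X ⊗ c_{Z,Y}⁻¹)` and the left unit
isomorphism `λ_X = ρ_X ∘ c_{I,X}`, the monoidal unit axiom
`(ρ_X ⊗ 1_Y) ∘ α_{X,I,Y} = 1_X ⊗ λ_Y : X⊗(I⊗Y) → X⊗Y` holds. -/
theorem ubcat_unit_axiom (B : UBCat C) (h₁ : B.UnitCoh) (h₂ : B.MixedCoh)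
    (a : ∀ X Y Z : C, B.tensorObj X (B.tensorObj Y Z) ⟶ B.tensorObj (B.tensorObj X Y) Z)
    (ha : ∀ X Y Z : C,
      a X Y Z = B.tensorHom (𝟙 X) (B.c Z Y).inv ≫ (B.β Z X Y).inv
        ≫ (B.c Z (B.tensorObj X Y)).hom)
    (lam : ∀ X : C, B.tensorObj B.unit X ⟶ X)
    (hlam : ∀ X : C, lam X = (B.c B.unit X).hom ≫ (B.ρ X).hom)
    (X Y : C) :
    a X B.unit Y ≫ B.tensorHom (B.ρ X).hom (𝟙 Y)
      = B.tensorHom (𝟙 X) (lam Y) := by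
  rw [ha, hlam]
  have hc : (B.c Y B.unit).inv = (B.c B.unit Y).hom := by
    rw [← cancel_epi (B.c Y B.unit).hom, Iso.hom_inv_id, UBCat.c_unit_symmetry h₁ h₂ Y]
  have hβ : (B.β Y X B.unit).inv ≫ B.tensorHom (𝟙 Y) (B.ρ X).hom ≫ (B.c Y X).hom =
      B.tensorHom (𝟙 X) (B.ρ Y).hom := by
    rw [Iso.inv_comp_eq, B.β_unit_right]
    simp [UBCat.tensorHom_comp_tensorHom, B.tensorHom_id]
  rw [hc, Category.assoc, Category.assoc, ← B.c_naturality, hβ, ← B.tensorHom_comp,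
    Category.comp_id]
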